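/- arXiv:2304.03082 — 4 statements merged into one kernel-verified Lean document; each statement's English description precedes it below -/
import Mathlib

section
/- Let m ≥ 1, let H : ℝ^{2m} → ℝ be continuously differentiable, and let f, g : ℝ^{2m} → ℝ be continuously differentiable with f compactly supported. Then ∫_{ℝ^{2m}} {f,g}(x) e^{-H(x)} dx = ∫_{ℝ^{2m}} g(x) {f,H}(x) e^{-H(x)} dx, where the integrals are with respect to Lebesgue measure and both integrands are compactly supported. In particular, if e^{-H} is Lebesgue integrable, the Gibbs probability measure dμ := Z^{-1} e^{-H} dx with Z := ∫ e^{-H} dx satisfies the classical KMS condition ∫ {f,g} dμ = ∫ g {f,H} dμ for all such f, g. -/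
open MeasureTheory
/-- The standard Poisson bracket on `ℝ^{2m}`:
`{f,g} := Σ_{i=1}^m (∂f/∂x_i · ∂g/∂x_{m+i} − ∂f/∂x_{m+i} · ∂g/∂x_i)`. -/
noncomputable def poissonBracket (m : ℕ) (f g : (Fin (2 * m) → ℝ) → ℝ)
    (x : Fin (2 * m) → ℝ) : ℝ :=
  ∑ i : Fin m,
    (fderiv ℝ f x (Pi.single (⟨i.1, by have := i.isLt; omega⟩ : Fin (2 * m)) 1) *
        fderiv ℝ g x (Pi.single (⟨m + i.1, by have := i.isLt; omega⟩ : Fin (2 * m)) 1) -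
      fderiv ℝ f x (Pi.single (⟨m + i.1, by have := i.isLt; omega⟩ : Fin (2 * m)) 1) *
        fderiv ℝ g x (Pi.single (⟨i.1, by have := i.isLt; omega⟩ : Fin (2 * m)) 1))

/-- The Gibbs probability measure `dμ := Z⁻¹ e^{-H} dx` on `ℝ^{2m}`,
where `Z := ∫ e^{-H} dx`. -/
noncomputable def gibbsM (m : ℕ) (H : (Fin (2 * m) → ℝ) → ℝ) :
    Measure (Fin (2 * m) → ℝ) :=
  (ENNReal.ofReal (∫ x : Fin (2 * m) → ℝ, Real.exp (-H x)))⁻¹ •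
    volume.withDensity fun x => ENNReal.ofReal (Real.exp (-H x))

section IntegrationByParts

variable {E : Type*} [NormedAddCommGroup E] [NormedSpace ℝ E] [MeasurableSpace E] [BorelSpace E]
  {μ : Measure E}

/-- Differentiation under the integral sign of `s ↦ ∫ f (x + s • v) * a x`, when the integrands
are supported in a common compact set for small `s`. -/
theorem hasDerivAt_integral_comp_add_smul_mul [IsFiniteMeasureOnCompacts μ] {f a : E → ℝ}
    (hf : ContDiff ℝ 1 f) (ha : Continuous a) (v : E) {K : Set E} (hK : IsCompact K)
    (hK₀ : ∀ x ∉ K, ∀ s : ℝ, |s| ≤ 1 → f (x + s • v) * a x = 0)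
    (hK₁ : ∀ x ∉ K, ∀ s : ℝ, |s| ≤ 1 → fderiv ℝ f (x + s • v) v * a x = 0) :
    HasDerivAt (fun s : ℝ => ∫ x, f (x + s • v) * a x ∂μ) (∫ x, fderiv ℝ f x v * a x ∂μ) 0 := by
  have hf' : Continuous (fderiv ℝ f) := hf.continuous_fderiv one_ne_zero
  have hfc : Continuous f := hf.continuous
  have supp {b : E → ℝ} (hb : ∀ x ∉ K, b x = 0) : HasCompactSupport b :=
    HasCompactSupport.intro hK hb
  have meas {b : E → ℝ} (hbc : Continuous b) (hb : ∀ x ∉ K, b x = 0) : Integrable b μ :=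
    hbc.integrable_of_hasCompactSupport (supp hb)
  have zero_case : ∀ x ∉ K, f (x + (0 : ℝ) • v) * a x = 0 := fun x hx => hK₀ x hx 0 (by simp)
  have hcont : Continuous fun p : ℝ × E => fderiv ℝ f (p.2 + p.1 • v) v * a p.2 := by fun_prop
  obtain ⟨C, hC⟩ := ((isCompact_closedBall (0 : ℝ) 1).prod hK).exists_bound_of_continuousOn
    hcont.continuousOn
  have key := hasDerivAt_integral_of_dominated_loc_of_deriv_le (μ := μ) (x₀ := (0 : ℝ))
    (F := fun s x => f (x + s • v) * a x)
    (F' := fun s x => fderiv ℝ f (x + s • v) v * a x)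
    (bound := K.indicator fun _ => C) (Metric.ball_mem_nhds 0 one_pos)
    (by
      filter_upwards [Metric.ball_mem_nhds (0 : ℝ) one_pos] with s hs
      refine (meas (by fun_prop) fun x hx => hK₀ x hx s ?_).aestronglyMeasurable
      simpa using (mem_ball_zero_iff.1 hs).le)
    (meas (by fun_prop) zero_case)
    (meas (by fun_prop) fun x hx => hK₁ x hx 0 (by simp)).aestronglyMeasurable
    (by
      refine Filter.Eventually.of_forall fun x s hs => ?_
      by_cases hx : x ∈ K
      · simpa [hx] using hC (s, x) ⟨Metric.ball_subset_closedBall hs, hx⟩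
      · simp only [Set.indicator_of_notMem hx]
        rw [hK₁ x hx s (by simpa using (mem_ball_zero_iff.1 hs).le), norm_zero])
    (by
      rw [integrable_indicator_iff hK.measurableSet]
      exact integrableOn_const hK.measure_lt_top.ne)
    (by
      refine Filter.Eventually.of_forall fun x s _ => HasDerivAt.mul_const ?_ _
      have h1 : HasDerivAt (fun s : ℝ => x + s • v) v s := by
        simpa using ((hasDerivAt_id s).smul_const v).const_add x
      exact ((hf.differentiable one_ne_zero) _).hasFDerivAt.comp_hasDerivAt s h1)
  simpa using key.2

/-- Two directional derivatives can be exchanged in `∫ ∂ᵥf * ∂_w u` when `f` and `u` are only `C¹`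
and `f` is compactly supported. -/
theorem integral_fderiv_mul_fderiv_comm [FiniteDimensional ℝ E] [μ.IsAddHaarMeasure]
    {f u : E → ℝ} (hf : ContDiff ℝ 1 f) (hu : ContDiff ℝ 1 u) (hfc : HasCompactSupport f)
    (v w : E) :
    ∫ x, fderiv ℝ f x v * fderiv ℝ u x w ∂μ = ∫ x, fderiv ℝ f x w * fderiv ℝ u x v ∂μ := by
  have hf' : Continuous (fderiv ℝ f) := hf.continuous_fderiv one_ne_zero
  have hu' : Continuous (fderiv ℝ u) := hu.continuous_fderiv one_ne_zero
  have hfcont : Continuous f := hf.continuous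
  have hucont : Continuous u := hu.continuous
  have hf'0 : ∀ x ∉ tsupport f, fderiv ℝ f x = 0 := fun x hx =>
    image_eq_zero_of_notMem_tsupport fun h => hx (tsupport_fderiv_subset ℝ h)
  let K : Set E := (fun p : E × ℝ => p.1 - p.2 • v) '' (tsupport f ×ˢ Metric.closedBall 0 1)
  have hK : IsCompact K := (hfc.isCompact.prod (isCompact_closedBall 0 1)).image (by fun_prop)
  have hKout : ∀ x ∉ K, ∀ s : ℝ, |s| ≤ 1 → x + s • v ∉ tsupport f := fun x hx s hs h =>
    hx ⟨(x + s • v, s), ⟨h, by simpa using hs⟩, by simp⟩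
  have hleft := hasDerivAt_integral_comp_add_smul_mul (μ := μ) hf
    (show Continuous fun x => fderiv ℝ u x w by fun_prop) v hK
    (fun x hx s hs => by simp [image_eq_zero_of_notMem_tsupport (hKout x hx s hs)])
    (fun x hx s hs => by simp [hf'0 _ (hKout x hx s hs)])
  have hright := hasDerivAt_integral_comp_add_smul_mul (μ := μ) hu
    (show Continuous fun x => fderiv ℝ f x w by fun_prop) (-v) hfc.isCompact
    (fun x hx s _ => by simp [hf'0 x hx])
    (fun x hx s _ => by simp [hf'0 x hx])
  have heq : (fun s : ℝ => ∫ x, f (x + s • v) * fderiv ℝ u x w ∂μ) =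
      fun s : ℝ => -∫ x, u (x + s • -v) * fderiv ℝ f x w ∂μ := by
    funext s
    have hsc : HasCompactSupport fun x => f (x + s • v) :=
      hfc.comp_homeomorph (Homeomorph.addRight (s • v))
    have hsc' : HasCompactSupport fun x => fderiv ℝ f (x + s • v) w :=
      (hfc.fderiv_apply ℝ w).comp_homeomorph (Homeomorph.addRight (s • v))
    have hder (x : E) : fderiv ℝ (fun x => f (x + s • v)) x = fderiv ℝ f (x + s • v) :=
      fderiv_comp_add_right _
    rw [integral_mul_fderiv_eq_neg_fderiv_mul_of_integrable]
    · simp only [hder]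
      rw [← integral_add_right_eq_self (fun x => u (x + s • -v) * fderiv ℝ f x w) (s • v)]
      simp [mul_comm]
    · simp only [hder]
      exact Continuous.integrable_of_hasCompactSupport (by fun_prop) hsc'.mul_right
    · exact Continuous.integrable_of_hasCompactSupport (by fun_prop) hsc.mul_right
    · exact Continuous.integrable_of_hasCompactSupport (by fun_prop) hsc.mul_right
    · exact fun x _ => (hf.differentiable one_ne_zero).comp (by fun_prop) x
    · exact fun x _ => hu.differentiable one_ne_zero x
  rw [heq] at hleft
  have h := hleft.unique hright.neg
  rw [h, ← integral_neg]
  simp [mul_comm]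

end IntegrationByParts

theorem hasCompactSupport_poissonBracket {m : ℕ} {f : (Fin (2 * m) → ℝ) → ℝ}
    (hfc : HasCompactSupport f) (h : (Fin (2 * m) → ℝ) → ℝ) :
    HasCompactSupport (poissonBracket m f h) :=
  HasCompactSupport.intro hfc.isCompact fun x hx => by
    have : fderiv ℝ f x = 0 :=
      image_eq_zero_of_notMem_tsupport fun h' => hx (tsupport_fderiv_subset ℝ h')
    simp [poissonBracket, this]

theorem continuous_poissonBracket {m : ℕ} {f g : (Fin (2 * m) → ℝ) → ℝ}
    (hf : ContDiff ℝ 1 f) (hg : ContDiff ℝ 1 g) : Continuous (poissonBracket m f g) := by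
  have hf' : Continuous (fderiv ℝ f) := hf.continuous_fderiv one_ne_zero
  have hg' : Continuous (fderiv ℝ g) := hg.continuous_fderiv one_ne_zero
  unfold poissonBracket
  fun_prop

theorem integral_poissonBracket_eq_zero {m : ℕ} {f u : (Fin (2 * m) → ℝ) → ℝ}
    (hf : ContDiff ℝ 1 f) (hu : ContDiff ℝ 1 u) (hfc : HasCompactSupport f) :
    ∫ x, poissonBracket m f u x = 0 := by
  have hf' : Continuous (fderiv ℝ f) := hf.continuous_fderiv one_ne_zero
  have hu' : Continuous (fderiv ℝ u) := hu.continuous_fderiv one_ne_zero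
  have hint (v w : Fin (2 * m) → ℝ) : Integrable fun x => fderiv ℝ f x v * fderiv ℝ u x w :=
    Continuous.integrable_of_hasCompactSupport (by fun_prop) (hfc.fderiv_apply ℝ v).mul_right
  unfold poissonBracket
  rw [integral_finsetSum]
  swap
  · exact fun i _ => (hint _ _).sub (hint _ _)
  refine Finset.sum_eq_zero fun i _ => ?_
  rw [integral_sub (hint _ _) (hint _ _), integral_fderiv_mul_fderiv_comm hf hu hfc, sub_self]

theorem poissonBracket_mul_exp_neg {m : ℕ} {H g : (Fin (2 * m) → ℝ) → ℝ}
    (f : (Fin (2 * m) → ℝ) → ℝ) {x : Fin (2 * m) → ℝ}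
    (hH : DifferentiableAt ℝ H x) (hg : DifferentiableAt ℝ g x) :
    poissonBracket m f (fun y => g y * Real.exp (-H y)) x =
      poissonBracket m f g x * Real.exp (-H x) -
        g x * poissonBracket m f H x * Real.exp (-H x) := by
  have hd (v : Fin (2 * m) → ℝ) : fderiv ℝ (fun y => g y * Real.exp (-H y)) x v =
      fderiv ℝ g x v * Real.exp (-H x) - g x * fderiv ℝ H x v * Real.exp (-H x) := by
    rw [(hg.hasFDerivAt.fun_mul hH.hasFDerivAt.fun_neg.exp).fderiv]
    simp
    ring
  simp only [poissonBracket, hd]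
  rw [Finset.sum_mul, Finset.mul_sum, Finset.sum_mul, ← Finset.sum_sub_distrib]
  exact Finset.sum_congr rfl fun i _ => by ring

theorem integral_gibbsM {m : ℕ} {H : (Fin (2 * m) → ℝ) → ℝ} (hH : Continuous H)
    (b : (Fin (2 * m) → ℝ) → ℝ) :
    ∫ x, b x ∂(gibbsM m H) =
      (ENNReal.ofReal (∫ x, Real.exp (-H x)))⁻¹.toReal * ∫ x, b x * Real.exp (-H x) := by
  rw [gibbsM, integral_smul_measure, integral_withDensity_eq_integral_toReal_smul
    (by fun_prop) (by simp)]
  simp [ENNReal.toReal_ofReal (Real.exp_nonneg _), mul_comm]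

/-- Let `m ≥ 1`, `H : ℝ^{2m} → ℝ` be `C¹`, and `f, g : ℝ^{2m} → ℝ` be `C¹` with `f`
compactly supported. Then both integrands `{f,g} e^{-H}` and `g {f,H} e^{-H}` are
compactly supported and `∫ {f,g} e^{-H} dx = ∫ g {f,H} e^{-H} dx` (Lebesgue measure).
In particular, if `e^{-H}` is Lebesgue integrable, the Gibbs probability measure
`dμ := Z⁻¹ e^{-H} dx` satisfies the classical KMS condition
`∫ {f,g} dμ = ∫ g {f,H} dμ` for all such `f, g`. -/
theorem stmt11 (m : ℕ) (hm : 1 ≤ m) (H f g : (Fin (2 * m) → ℝ) → ℝ)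
    (hH : ContDiff ℝ 1 H) (hf : ContDiff ℝ 1 f) (hg : ContDiff ℝ 1 g)
    (hfc : HasCompactSupport f) :
    HasCompactSupport (fun x => poissonBracket m f g x * Real.exp (-H x)) ∧
    HasCompactSupport (fun x => g x * poissonBracket m f H x * Real.exp (-H x)) ∧
    (∫ x : Fin (2 * m) → ℝ, poissonBracket m f g x * Real.exp (-H x) =
      ∫ x : Fin (2 * m) → ℝ, g x * poissonBracket m f H x * Real.exp (-H x)) ∧
    (Integrable (fun x : Fin (2 * m) → ℝ => Real.exp (-H x)) →
      ∫ x, poissonBracket m f g x ∂(gibbsM m H) =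
        ∫ x, g x * poissonBracket m f H x ∂(gibbsM m H)) := by
  have hbg : HasCompactSupport fun x => poissonBracket m f g x * Real.exp (-H x) :=
    (hasCompactSupport_poissonBracket hfc g).mul_right
  have hbH : HasCompactSupport fun x => g x * poissonBracket m f H x * Real.exp (-H x) :=
    ((hasCompactSupport_poissonBracket hfc H).mul_left (f := g)).mul_right
  have hHc : Continuous H := hH.continuous
  have hgc : Continuous g := hg.continuous
  have hcg := continuous_poissonBracket hf hg
  have hcH := continuous_poissonBracket hf hH
  have heq : ∫ x : Fin (2 * m) → ℝ, poissonBracket m f g x * Real.exp (-H x) =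
      ∫ x : Fin (2 * m) → ℝ, g x * poissonBracket m f H x * Real.exp (-H x) := by
    have h0 := integral_poissonBracket_eq_zero hf (hg.mul hH.neg.exp) hfc
    simp only [poissonBracket_mul_exp_neg f (hH.differentiable one_ne_zero _)
      (hg.differentiable one_ne_zero _)] at h0
    rw [integral_sub (Continuous.integrable_of_hasCompactSupport (by fun_prop) hbg)
      (Continuous.integrable_of_hasCompactSupport (by fun_prop) hbH)] at h0
    exact sub_eq_zero.1 h0
  refine ⟨hbg, hbH, heq, fun _ => ?_⟩
  rw [integral_gibbsM hHc, integral_gibbsM hHc, heq]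
end

section
/- Let n ≥ 1 and let μ be a Borel measure on ℝ^n that is finite on compact sets. Suppose that for every smooth compactly supported function f : ℝ^n → ℝ and every vector v ∈ ℝ^n one has ∫_{ℝ^n} (D_v f)(x) dμ(x) = 0, where D_v f denotes the directional derivative of f in direction v. Then there exists a constant c ≥ 0 such that μ = c · λ, where λ is Lebesgue measure on ℝ^n; i.e., Lebesgue measure is, up to a multiplicative constant, the unique locally finite Borel measure vanishing on derivatives of compactly supported smooth functions. -/
open MeasureTheory
open scoped NNReal

open Filter Metric Set Function Topology Manifold in
/-- Two measures that are finite on compact sets and integrate every smooth compactly supported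
function in the same way are equal. -/
theorem MeasureTheory.Measure.ext_of_integral_contDiff_eq {E : Type*} [NormedAddCommGroup E] [NormedSpace ℝ E]
    [FiniteDimensional ℝ E] [MeasurableSpace E] [BorelSpace E] {μ ν : Measure E}
    [IsFiniteMeasureOnCompacts μ] [IsFiniteMeasureOnCompacts ν]
    (h : ∀ f : E → ℝ, ContDiff ℝ (⊤ : ℕ∞) f → HasCompactSupport f →
      ∫ x, f x ∂μ = ∫ x, f x ∂ν) : μ = ν := by
  have : ProperSpace E := FiniteDimensional.proper ℝ E
  have compact_eq : ∀ K : Set E, IsCompact K → μ K = ν K := by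
    intro K hK
    obtain ⟨f, f_smooth, f_range, f_supp, f_one⟩ :=
      exists_contMDiff_support_eq_eq_one_iff 𝓘(ℝ, E) (isOpen_thickening (δ := 1) (E := K))
        hK.isClosed (self_subset_thickening one_pos K)
    have f_diff : ContDiff ℝ (⊤ : ℕ∞) f := f_smooth.contDiff
    have f_nonneg (x : E) : 0 ≤ f x := (f_range (mem_range_self x)).1
    have f_le_one (x : E) : f x ≤ 1 := (f_range (mem_range_self x)).2
    have f_comp : HasCompactSupport f :=
      HasCompactSupport.of_support_subset_isCompact (hK.cthickening (r := 1))
        (f_supp ▸ thickening_subset_cthickening 1 K)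
    have tendsto_pow (ρ : Measure E) [IsFiniteMeasureOnCompacts ρ] :
        Tendsto (fun n : ℕ ↦ ∫ x, f x ^ (n + 1) ∂ρ) atTop (𝓝 (ρ.real K)) := by
      rw [← integral_indicator_one hK.measurableSet]
      refine tendsto_integral_of_dominated_convergence f
        (fun n ↦ (f_diff.continuous.pow _).aestronglyMeasurable)
        (f_diff.continuous.integrable_of_hasCompactSupport f_comp)
        (fun n ↦ .of_forall fun x ↦ ?_) (.of_forall fun x ↦ ?_)
      · rw [Real.norm_of_nonneg (pow_nonneg (f_nonneg x) _)]
        exact pow_le_of_le_one (f_nonneg x) (f_le_one x) n.succ_ne_zero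
      · by_cases hx : x ∈ K
        · simp [hx, (f_one x).1 hx]
        · have hlt : f x < 1 := (f_le_one x).lt_of_ne fun h1 ↦ hx ((f_one x).2 h1)
          simpa [hx] using (tendsto_add_atTop_iff_nat 1).2
            (tendsto_pow_atTop_nhds_zero_of_lt_one (f_nonneg x) hlt)
    have real_eq : μ.real K = ν.real K := by
      refine tendsto_nhds_unique (tendsto_pow μ) ((tendsto_pow ν).congr fun n ↦ ?_)
      refine (h (fun x ↦ f x ^ (n + 1)) (f_diff.pow _) (f_comp.mono fun x hx ↦ ?_)).symm
      exact ne_zero_pow n.succ_ne_zero hx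
    exact (measureReal_eq_measureReal_iff hK.measure_lt_top.ne hK.measure_lt_top.ne).1 real_eq
  ext s hs
  rw [hs.measure_eq_iSup_isCompact, hs.measure_eq_iSup_isCompact]
  congr! 4 with K _ hK
  exact compact_eq K hK

open Metric Set in
/-- If a measure vanishes on the derivatives in direction `v` of smooth compactly supported
functions, then the integral of such a function is unchanged by translation by `v`. -/
theorem integral_add_eq_of_integral_fderiv_eq_zero {E : Type*} [NormedAddCommGroup E]
    [NormedSpace ℝ E] [FiniteDimensional ℝ E] [MeasurableSpace E] [BorelSpace E] {μ : Measure E}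
    [IsFiniteMeasureOnCompacts μ] {v : E}
    (h : ∀ f : E → ℝ, ContDiff ℝ (⊤ : ℕ∞) f → HasCompactSupport f →
      ∫ x, fderiv ℝ f x v ∂μ = 0)
    {f : E → ℝ} (hf : ContDiff ℝ (⊤ : ℕ∞) f) (hfc : HasCompactSupport f) :
    ∫ x, f (x + v) ∂μ = ∫ x, f x ∂μ := by
  have diff : Differentiable ℝ f := hf.differentiable (by simp)
  have cont_fderiv : Continuous fun x ↦ fderiv ℝ f x v :=
    (hf.continuous_fderiv (by simp)).clm_apply continuous_const
  have comp_translate (t : ℝ) : HasCompactSupport fun x ↦ f (x + t • v) :=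
    hfc.comp_homeomorph (Homeomorph.addRight (t • v))
  have diff_translate (t : ℝ) : ContDiff ℝ (⊤ : ℕ∞) fun x ↦ f (x + t • v) :=
    hf.comp (contDiff_id.add contDiff_const)
  obtain ⟨C, hC⟩ := (hfc.fderiv_apply (𝕜 := ℝ) v).exists_bound_of_continuous cont_fderiv
  have deriv_integral (t₀ : ℝ) : HasDerivAt (fun t : ℝ ↦ ∫ x, f (x + t • v) ∂μ) 0 t₀ := by
    let K : Set E := (fun p : E × ℝ ↦ p.1 - p.2 • v) '' (tsupport f ×ˢ closedBall t₀ 1)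
    have hK : IsCompact K :=
      (IsCompact.prod hfc (isCompact_closedBall t₀ 1)).image (by fun_prop)
    have key := (hasDerivAt_integral_of_dominated_loc_of_deriv_le (μ := μ)
      (F := fun t x ↦ f (x + t • v)) (F' := fun t x ↦ fderiv ℝ f (x + t • v) v)
      (bound := K.indicator fun _ ↦ C) (ball_mem_nhds t₀ one_pos)
      (.of_forall fun t ↦ (diff_translate t).continuous.aestronglyMeasurable)
      ((diff_translate t₀).continuous.integrable_of_hasCompactSupport (comp_translate t₀))
      (cont_fderiv.comp (continuous_add_const _)).aestronglyMeasurable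
      (.of_forall fun x t ht ↦ ?_)
      ((integrable_indicator_iff hK.measurableSet).2
        (integrableOn_const hK.measure_lt_top.ne))
      (.of_forall fun x t _ ↦ ?_)).2
    · have fderiv_translate (x : E) :
          fderiv ℝ (fun y ↦ f (y + t₀ • v)) x = fderiv ℝ f (x + t₀ • v) :=
        fderiv_comp_add_right (t₀ • v)
      simpa [← fderiv_translate, h _ (diff_translate t₀) (comp_translate t₀)] using key
    · by_cases hx : x ∈ K
      · simpa [hx] using hC (x + t • v)
      · have notMem : x + t • v ∉ tsupport f := fun hmem ↦
          hx ⟨(x + t • v, t), ⟨hmem, ball_subset_closedBall ht⟩, by simp⟩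
        have : fderiv ℝ f (x + t • v) = 0 :=
          image_eq_zero_of_notMem_tsupport fun hmem ↦ notMem (tsupport_fderiv_subset ℝ hmem)
        simp [hx, this]
    · have line : HasDerivAt (fun s : ℝ ↦ x + s • v) v t := by
        simpa using ((hasDerivAt_id t).smul_const v).const_add x
      exact (diff (x + t • v)).hasFDerivAt.comp_hasDerivAt t line
  simpa using is_const_of_deriv_eq_zero (fun t ↦ (deriv_integral t).differentiableAt)
    (fun t ↦ (deriv_integral t).deriv) 1 0

/-- Let `n ≥ 1` and let `μ` be a Borel measure on `ℝ^n` that is finite on compact sets.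
If `∫ D_v f dμ = 0` for every smooth compactly supported `f : ℝ^n → ℝ` and every direction
`v ∈ ℝ^n`, then `μ = c · λ` for some constant `c ≥ 0`, where `λ` is Lebesgue measure:
Lebesgue measure is, up to a multiplicative constant, the unique locally finite Borel
measure vanishing on derivatives of compactly supported smooth functions. -/
theorem stmt12 (n : ℕ) (hn : 1 ≤ n) (μ : Measure (Fin n → ℝ))
    [IsFiniteMeasureOnCompacts μ]
    (h : ∀ f : (Fin n → ℝ) → ℝ, ContDiff ℝ (⊤ : ℕ∞) f → HasCompactSupport f →
      ∀ v : Fin n → ℝ, ∫ x, fderiv ℝ f x v ∂μ = 0) :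
    ∃ c : ℝ≥0, μ = c • (volume : Measure (Fin n → ℝ)) := by
  have : μ.IsAddLeftInvariant := by
    refine ⟨fun v ↦ ?_⟩
    have : IsFiniteMeasureOnCompacts (μ.map (v + ·)) :=
      Measure.IsFiniteMeasureOnCompacts.map μ (Homeomorph.addLeft v)
    refine Measure.ext_of_integral_contDiff_eq fun f hf hfc ↦ ?_
    rw [(measurableEmbedding_addLeft v).integral_map]
    simpa [add_comm] using integral_add_eq_of_integral_fderiv_eq_zero
      (fun g hg hgc ↦ h g hg hgc v) hf hfc
  exact ⟨μ.addHaarScalarFactor volume, Measure.isAddLeftInvariant_eq_smul μ volume⟩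
end

section
/- Let m ≥ 1 and let μ be a Borel measure on ℝ^{2m} that is finite on compact sets. Suppose that ∫_{ℝ^{2m}} {f,g}(x) dμ(x) = 0 for all smooth compactly supported f, g : ℝ^{2m} → ℝ, where {f,g} is the standard Poisson bracket. Then there exists a constant c ≥ 0 such that μ = c · λ, where λ is Lebesgue measure on ℝ^{2m}. Consequently, the unique Borel probability measure on a fixed open box invariant under all Hamiltonian flows of compactly supported Hamiltonians is the normalized Lebesgue measure. -/
open MeasureTheory
open scoped NNReal
namespace MeasureTheory.Measure

variable {E : Type*} [NormedAddCommGroup E] [NormedSpace ℝ E] [MeasurableSpace E] [BorelSpace E]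

private lemma measure_le_of_integral_contDiff_eq [FiniteDimensional ℝ E] {μ ν : Measure E}
    [IsFiniteMeasureOnCompacts μ]
    (h : ∀ f : E → ℝ, ContDiff ℝ (⊤ : ℕ∞) f → HasCompactSupport f →
      ∫ x, f x ∂μ = ∫ x, f x ∂ν) {U : Set E} (hU : IsOpen U) (hb : Bornology.IsBounded U) :
    μ U ≤ ν U := by
  have : ProperSpace E := FiniteDimensional.proper ℝ E
  rw [hU.measure_eq_iSup_isCompact]
  refine iSup₂_le fun K hKU => iSup_le fun hK => ?_
  obtain ⟨f, hf, hrange, hsupp, hone⟩ :=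
    exists_contMDiff_support_eq_eq_one_iff (n := (⊤ : ℕ∞)) (modelWithCornersSelf ℝ E)
      hU hK.isClosed hKU
  have hfc : HasCompactSupport f :=
    HasCompactSupport.of_support_subset_isCompact hb.isCompact_closure
      (hsupp.subset.trans subset_closure)
  calc
    μ K ≤ ENNReal.ofReal (∫ x, f x ∂μ) :=
      (hf.continuous.integrable_of_hasCompactSupport hfc).measure_le_integral
        (Filter.Eventually.of_forall fun x => (hrange ⟨x, rfl⟩).1)
        fun x hx => ((hone x).1 hx).ge
    _ = ENNReal.ofReal (∫ x, f x ∂ν) := by rw [h f hf.contDiff hfc]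
    _ ≤ ν U := integral_le_measure (fun x _ => (hrange ⟨x, rfl⟩).2) fun x hx => by
      have : x ∉ Function.support f := by rwa [hsupp]
      exact (Function.notMem_support.1 this).le

/-- Two locally finite measures on a finite-dimensional space which integrate smooth compactly
supported functions in the same way are equal. -/
theorem ext_of_integral_contDiff [FiniteDimensional ℝ E] {μ ν : Measure E}
    [IsFiniteMeasureOnCompacts μ] [IsFiniteMeasureOnCompacts ν]
    (h : ∀ f : E → ℝ, ContDiff ℝ (⊤ : ℕ∞) f → HasCompactSupport f →
      ∫ x, f x ∂μ = ∫ x, f x ∂ν) : μ = ν := by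
  have : ProperSpace E := FiniteDimensional.proper ℝ E
  exact OuterRegular.ext_isOpen_isBounded fun U hU hb => le_antisymm
    (measure_le_of_integral_contDiff_eq h hU hb)
    (measure_le_of_integral_contDiff_eq (fun f hf hc => (h f hf hc).symm) hU hb)

/-- If the distributional derivative of `μ` in the direction `v` vanishes, then integrals of smooth
compactly supported functions are invariant under translation by `v`. -/
theorem integral_comp_add_eq_of_integral_fderiv_eq_zero {μ : Measure E}
    [IsFiniteMeasureOnCompacts μ] {v : E}
    (h : ∀ f : E → ℝ, ContDiff ℝ (⊤ : ℕ∞) f → HasCompactSupport f →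
      ∫ x, fderiv ℝ f x v ∂μ = 0)
    {f : E → ℝ} (hf : ContDiff ℝ (⊤ : ℕ∞) f) (hfc : HasCompactSupport f) :
    ∫ x, f (x + v) ∂μ = ∫ x, f x ∂μ := by
  have hd : Differentiable ℝ f := hf.differentiable (by simp)
  have hcont : Continuous fun x => fderiv ℝ f x v :=
    (hf.continuous_fderiv (by simp)).clm_apply continuous_const
  have hcs (t : ℝ) : HasCompactSupport fun x => f (x + t • v) :=
    hfc.comp_homeomorph (Homeomorph.addRight (t • v))
  have hsm (t : ℝ) : ContDiff ℝ (⊤ : ℕ∞) fun x => f (x + t • v) :=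
    hf.comp (contDiff_id.add contDiff_const)
  obtain ⟨C, hC⟩ : ∃ C, ∀ x, ‖fderiv ℝ f x v‖ ≤ C :=
    (hfc.fderiv_apply (𝕜 := ℝ) v).exists_bound_of_continuous hcont
  have key (t : ℝ) : HasDerivAt (fun s : ℝ => ∫ x, f (x + s • v) ∂μ) 0 t := by
    let K : Set E := (fun p : E × ℝ => p.1 - p.2 • v) '' (tsupport f ×ˢ Metric.closedBall t 1)
    have hK : IsCompact K :=
      (hfc.isCompact.prod (isCompact_closedBall t 1)).image (by fun_prop)
    have hderiv := hasDerivAt_integral_of_dominated_loc_of_deriv_le (μ := μ)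
      (F := fun s x => f (x + s • v)) (F' := fun s x => fderiv ℝ f (x + s • v) v)
      (bound := K.indicator fun _ => C) (x₀ := t) (Metric.closedBall_mem_nhds t one_pos)
      (Filter.Eventually.of_forall fun s => (hsm s).continuous.aestronglyMeasurable)
      ((hsm t).continuous.integrable_of_hasCompactSupport (hcs t))
      (hcont.comp (continuous_id.add continuous_const)).aestronglyMeasurable
      (Filter.Eventually.of_forall fun x s hs => by
        by_cases hx : x ∈ K
        · simpa [hx] using hC _
        · have : x + s • v ∉ tsupport f := fun hmem =>
            hx ⟨(x + s • v, s), ⟨hmem, hs⟩, by simp⟩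
          simp [hx, fderiv_of_notMem_tsupport ℝ this])
      ((integrable_indicator_iff hK.measurableSet).2
        (integrableOn_const hK.measure_lt_top.ne))
      (Filter.Eventually.of_forall fun x s _ => by
        have h1 : HasDerivAt (fun s : ℝ => x + s • v) v s := by
          simpa using ((hasDerivAt_id s).smul_const v).const_add x
        exact (hd _).hasFDerivAt.comp_hasDerivAt s h1)
    have hzero := h _ (hsm t) (hcs t)
    simp only [fderiv_comp_add_right] at hzero
    simpa only [hzero] using hderiv.2
  have := is_const_of_deriv_eq_zero (fun t => (key t).differentiableAt)
    (fun t => (key t).deriv) 1 0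
  simpa using this

/-- A locally finite measure whose distributional derivatives all vanish is translation
invariant. -/
theorem isAddLeftInvariant_of_integral_fderiv_eq_zero [FiniteDimensional ℝ E] {μ : Measure E}
    [IsFiniteMeasureOnCompacts μ]
    (h : ∀ f : E → ℝ, ContDiff ℝ (⊤ : ℕ∞) f → HasCompactSupport f →
      ∀ v, ∫ x, fderiv ℝ f x v ∂μ = 0) : μ.IsAddLeftInvariant := by
  refine ⟨fun v => ?_⟩
  have : IsFiniteMeasureOnCompacts (μ.map (v + ·)) :=
    IsFiniteMeasureOnCompacts.map μ (Homeomorph.addLeft v)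
  refine ext_of_integral_contDiff fun f hf hfc => ?_
  rw [integral_map (by fun_prop) hf.continuous.aestronglyMeasurable]
  simpa only [add_comm v] using
    integral_comp_add_eq_of_integral_fderiv_eq_zero (fun f hf hfc => h f hf hfc v) hf hfc

end MeasureTheory.Measure

/-- Given a compactly supported `f` and a linear form `L`, there is a smooth compactly supported
function with derivative `L` at every point of the support of `f`. -/
theorem HasCompactSupport.exists_contDiff_fderiv_eq {E : Type*} [NormedAddCommGroup E]
    [NormedSpace ℝ E] [FiniteDimensional ℝ E] {f : E → ℝ} (hf : HasCompactSupport f)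
    (L : E →L[ℝ] ℝ) :
    ∃ g : E → ℝ, ContDiff ℝ (⊤ : ℕ∞) g ∧ HasCompactSupport g ∧
      ∀ x ∈ tsupport f, fderiv ℝ g x = L := by
  obtain ⟨R, hR, hsub⟩ := hf.isCompact.isBounded.subset_ball_lt 0 (0 : E)
  let χ : ContDiffBump (0 : E) := ⟨R, R + 1, hR, lt_add_one R⟩
  refine ⟨fun x => χ x * L x, χ.contDiff.mul L.contDiff, χ.hasCompactSupport.mul_right,
    fun x hx => ?_⟩
  have heq : (fun x => χ x * L x) =ᶠ[nhds x] L := by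
    filter_upwards [χ.eventuallyEq_one_of_mem_ball (hsub hx)] with y hy
    simp [hy]
  rw [heq.fderiv_eq, L.fderiv]

/-- If all Poisson brackets integrate to zero, then so do all partial derivatives: the bracket of
`f` with a smooth cutoff of the conjugate coordinate is a partial derivative of `f`, up to sign. -/
theorem integral_fderiv_single_eq_zero_of_integral_poissonBracket (m : ℕ)
    (μ : Measure (Fin (2 * m) → ℝ))
    (h : ∀ f g : (Fin (2 * m) → ℝ) → ℝ, ContDiff ℝ (⊤ : ℕ∞) f → ContDiff ℝ (⊤ : ℕ∞) g →
      HasCompactSupport f → HasCompactSupport g →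
      ∫ x, poissonBracket m f g x ∂μ = 0)
    {f : (Fin (2 * m) → ℝ) → ℝ} (hf : ContDiff ℝ (⊤ : ℕ∞) f) (hfc : HasCompactSupport f)
    (j : Fin (2 * m)) : ∫ x, fderiv ℝ f x (Pi.single j 1) ∂μ = 0 := by
  have bracket (k : Fin (2 * m)) : ∃ g, ContDiff ℝ (⊤ : ℕ∞) g ∧ HasCompactSupport g ∧
      ∀ x, poissonBracket m f g x = ∑ i : Fin m,
        (fderiv ℝ f x (Pi.single (⟨i.1, by omega⟩ : Fin (2 * m)) 1) *
          (if k.1 = m + i.1 then 1 else 0) -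
        fderiv ℝ f x (Pi.single (⟨m + i.1, by omega⟩ : Fin (2 * m)) 1) *
          (if k.1 = i.1 then 1 else 0)) := by
    obtain ⟨g, hg, hgc, hL⟩ :=
      hfc.exists_contDiff_fderiv_eq (ContinuousLinearMap.proj (R := ℝ) (φ := fun _ => ℝ) k)
    refine ⟨g, hg, hgc, fun x => Finset.sum_congr rfl fun i _ => ?_⟩
    by_cases hx : x ∈ tsupport f
    · rw [hL x hx]
      simp [Pi.single_apply, Fin.ext_iff]
    · simp [fderiv_of_notMem_tsupport ℝ hx]
  by_cases hj : j.1 < m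
  · obtain ⟨g, hg, hgc, hb⟩ := bracket ⟨m + j.1, by omega⟩
    have hint := h f g hf hg hfc hgc
    have heq (x) : poissonBracket m f g x = fderiv ℝ f x (Pi.single j 1) := by
      rw [hb, Finset.sum_eq_single ⟨j.1, hj⟩]
      · have : m ≠ 0 := by omega
        simp [this]
      · intro i _ hi
        have h1 : j.1 ≠ i.1 := fun e => hi (Fin.ext e.symm)
        have h2 : m + j.1 ≠ i.1 := by omega
        simp [h1, h2]
      · simp
    simpa only [heq] using hint
  · obtain ⟨g, hg, hgc, hb⟩ := bracket ⟨j.1 - m, by omega⟩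
    have hint := h f g hf hg hfc hgc
    have heq (x) : poissonBracket m f g x = -fderiv ℝ f x (Pi.single j 1) := by
      rw [hb, Finset.sum_eq_single ⟨j.1 - m, by omega⟩]
      · have h1 : j.1 - m ≠ m + (j.1 - m) := by omega
        have h2 : m + (j.1 - m) = j.1 := by omega
        simp [h2, show j.1 - m ≠ j.1 by omega]
      · intro i _ hi
        have h1 : j.1 - m ≠ i.1 := fun e => hi (Fin.ext e.symm)
        have h2 : j.1 - m ≠ m + i.1 := by omega
        simp [h1, h2]
      · simp
    simpa only [heq, integral_neg, neg_eq_zero] using hint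

/-- Let `m ≥ 1` and let `μ` be a Borel measure on `ℝ^{2m}` that is finite on compact
sets. If `∫ {f,g} dμ = 0` for all smooth compactly supported `f, g : ℝ^{2m} → ℝ`, then
`μ = c · λ` for some constant `c ≥ 0`, `λ` being Lebesgue measure on `ℝ^{2m}`. -/
theorem stmt13 (m : ℕ) (hm : 1 ≤ m) (μ : Measure (Fin (2 * m) → ℝ))
    [IsFiniteMeasureOnCompacts μ]
    (h : ∀ f g : (Fin (2 * m) → ℝ) → ℝ, ContDiff ℝ (⊤ : ℕ∞) f → ContDiff ℝ (⊤ : ℕ∞) g →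
      HasCompactSupport f → HasCompactSupport g →
      ∫ x, poissonBracket m f g x ∂μ = 0) :
    ∃ c : ℝ≥0, μ = c • (volume : Measure (Fin (2 * m) → ℝ)) := by
  have hinv : μ.IsAddLeftInvariant := by
    refine Measure.isAddLeftInvariant_of_integral_fderiv_eq_zero fun f hf hfc v => ?_
    have hexp (x) : fderiv ℝ f x v = ∑ j, v j * fderiv ℝ f x (Pi.single j 1) := by
      conv_lhs => rw [pi_eq_sum_univ' v]
      simp [map_sum]
    have hint (j : Fin (2 * m)) : Integrable (fun x => fderiv ℝ f x (Pi.single j 1)) μ :=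
      ((hf.continuous_fderiv (by simp)).clm_apply
        continuous_const).integrable_of_hasCompactSupport (hfc.fderiv_apply (𝕜 := ℝ) _)
    simp_rw [hexp]
    rw [integral_finsetSum _ fun j _ => (hint j).const_mul _]
    simp [integral_const_mul,
      integral_fderiv_single_eq_zero_of_integral_poissonBracket m μ h hf hfc]
  exact ⟨_, Measure.isAddLeftInvariant_eq_smul μ volume⟩
end

section
/- Let m ≥ 1, let H : ℝ^{2m} → ℝ be continuously differentiable, and let μ be a finite Borel measure on ℝ^{2m} satisfying the classical KMS condition ∫ {f,g} dμ = ∫ g {f,H} dμ for all smooth compactly supported f, g : ℝ^{2m} → ℝ. Then there exists a constant c ≥ 0 such that μ has density c·e^{-H} with respect to Lebesgue measure, i.e. μ(A) = c ∫_A e^{-H(x)} dx for every Borel set A. -/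
open MeasureTheory
open scoped NNReal
open Filter Metric ContinuousLinearMap
open scoped Topology Convolution

section Mollification

lemma exists_seq_contDiffBump_tendsto {E : Type*} [NormedAddCommGroup E] :
    ∃ φ : ℕ → ContDiffBump (0 : E),
      Tendsto (fun n => (φ n).rOut) atTop (𝓝 0) ∧ ∀ n, (φ n).rOut ≤ 1 := by
  refine ⟨fun n => ⟨1 / ((n : ℝ) + 1) / 2, 1 / ((n : ℝ) + 1), by positivity,
    half_lt_self (by positivity)⟩, tendsto_one_div_add_atTop_nhds_zero_nat, fun n => ?_⟩
  rw [div_le_one (by positivity)]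
  linarith [n.cast_nonneg (α := ℝ)]

variable {E : Type*} [NormedAddCommGroup E] [NormedSpace ℝ E] [FiniteDimensional ℝ E]
  [MeasurableSpace E] [BorelSpace E] {lam : Measure E} [lam.IsAddHaarMeasure]

lemma tendsto_integral_normed_convolution_mul (μ : Measure E) [IsFiniteMeasureOnCompacts μ]
    {φ : ℕ → ContDiffBump (0 : E)} (hφ : Tendsto (fun n => (φ n).rOut) atTop (𝓝 0))
    (hφ1 : ∀ n, (φ n).rOut ≤ 1) {g w : E → ℝ} (hg : Continuous g) (hgs : HasCompactSupport g)
    (hw : Continuous w) :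
    Tendsto (fun n => ∫ x, ((φ n).normed lam ⋆[lsmul ℝ ℝ, lam] g) x * w x ∂μ) atTop
      (𝓝 (∫ x, g x * w x ∂μ)) := by
  obtain ⟨R, hR⟩ := hgs.isCompact.isBounded.subset_closedBall (0 : E)
  obtain ⟨M, hM⟩ := hgs.exists_bound_of_continuous hg
  have hM0 : 0 ≤ M := (norm_nonneg _).trans (hM 0)
  have hvanish : ∀ x, R < ‖x‖ → g x = 0 := fun x hx => by
    by_contra h
    have := hR (subset_tsupport _ h)
    rw [mem_closedBall_zero_iff] at this
    linarith
  refine tendsto_integral_of_dominated_convergence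
    ((closedBall (0 : E) (R + 1)).indicator fun x => 3 * M * ‖w x‖) (fun n => ?_) ?_ (fun n => ?_) ?_
  · have : Continuous ((φ n).normed lam ⋆[lsmul ℝ ℝ, lam] g) :=
      (φ n).hasCompactSupport_normed.continuous_convolution_left _ (φ n).continuous_normed
        hg.locallyIntegrable
    exact (this.mul hw).aestronglyMeasurable
  · rw [integrable_indicator_iff measurableSet_closedBall]
    exact (by fun_prop : Continuous fun x => 3 * M * ‖w x‖).continuousOn.integrableOn_compact
      (isCompact_closedBall _ _)
  · refine Eventually.of_forall fun x => ?_
    by_cases hx : x ∈ closedBall (0 : E) (R + 1)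
    · rw [Set.indicator_of_mem hx, norm_mul]
      gcongr
      have hd := (φ n).dist_normed_convolution_le (μ := lam) (x₀ := x) (ε := 2 * M)
        hg.aestronglyMeasurable fun y _ => by
          linarith [dist_le_norm_add_norm (g y) (g x), hM x, hM y]
      rw [dist_eq_norm] at hd
      have := norm_le_norm_add_norm_sub' (((φ n).normed lam ⋆[lsmul ℝ ℝ, lam] g) x) (g x)
      linarith [hM x]
    · rw [Set.indicator_of_notMem hx, (φ n).normed_convolution_eq_right]
      · rw [mem_closedBall_zero_iff, not_le] at hx
        simp [hvanish x (by linarith)]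
      · intro y hy
        rw [mem_closedBall_zero_iff, not_le] at hx
        rw [mem_ball, dist_eq_norm] at hy
        have h1 := norm_le_norm_add_norm_sub y x
        rw [hvanish x (by linarith), hvanish y (by linarith [hφ1 n])]
  · exact Eventually.of_forall fun x =>
      (ContDiffBump.convolution_tendsto_right_of_continuous hφ hg x).mul_const _

lemma ContDiffBump.fderiv_normed_convolution_apply (φ : ContDiffBump (0 : E)) {g : E → ℝ}
    (hg : ContDiff ℝ 1 g) (hgs : HasCompactSupport g) (x v : E) :
    fderiv ℝ (φ.normed lam ⋆[lsmul ℝ ℝ, lam] g) x v =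
      (φ.normed lam ⋆[lsmul ℝ ℝ, lam] fun y => fderiv ℝ g y v) x := by
  have hφ : LocallyIntegrable (φ.normed lam) lam := φ.continuous_normed.locallyIntegrable
  rw [(hgs.hasFDerivAt_convolution_right (lsmul ℝ ℝ) hφ hg x).fderiv,
    convolution_precompR_apply _ hφ (hgs.fderiv ℝ) (hg.continuous_fderiv one_ne_zero)]

lemma ContDiffBump.contDiff_normed_convolution (φ : ContDiffBump (0 : E)) {g : E → ℝ}
    (hg : Continuous g) :
    ContDiff ℝ (⊤ : ℕ∞) (φ.normed lam ⋆[lsmul ℝ ℝ, lam] g) :=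
  φ.hasCompactSupport_normed.contDiff_convolution_left _ φ.contDiff_normed hg.locallyIntegrable

lemma ContDiffBump.hasCompactSupport_normed_convolution (φ : ContDiffBump (0 : E)) {g : E → ℝ}
    (hgs : HasCompactSupport g) :
    HasCompactSupport (φ.normed lam ⋆[lsmul ℝ ℝ, lam] g) :=
  φ.hasCompactSupport_normed.convolution _ hgs

lemma integral_fderiv_eq_of_forall_smooth (μ : Measure E) [IsFiniteMeasureOnCompacts μ] (v : E)
    {w : E → ℝ} (hw : Continuous w)
    (h : ∀ g : E → ℝ, ContDiff ℝ (⊤ : ℕ∞) g → HasCompactSupport g →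
      ∫ x, fderiv ℝ g x v ∂μ = ∫ x, g x * w x ∂μ)
    {g : E → ℝ} (hg : ContDiff ℝ 1 g) (hgs : HasCompactSupport g) :
    ∫ x, fderiv ℝ g x v ∂μ = ∫ x, g x * w x ∂μ := by
  obtain ⟨φ, hφ, hφ1⟩ := exists_seq_contDiffBump_tendsto (E := E)
  let lam : Measure E := Measure.addHaar
  have hd := tendsto_integral_normed_convolution_mul (lam := lam) μ hφ hφ1
    (g := fun x => fderiv ℝ g x v) (w := fun _ => 1)
    ((hg.continuous_fderiv one_ne_zero).clm_apply continuous_const)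
    (hgs.fderiv_apply ℝ v) continuous_const
  have hr := tendsto_integral_normed_convolution_mul (lam := lam) μ hφ hφ1 hg.continuous hgs hw
  simp only [mul_one] at hd
  refine tendsto_nhds_unique hd (hr.congr fun n => ?_)
  rw [← h _ ((φ n).contDiff_normed_convolution hg.continuous)
    ((φ n).hasCompactSupport_normed_convolution hgs)]
  simp_rw [(φ n).fderiv_normed_convolution_apply hg hgs]

lemma integral_comp_add_eq_of_integral_fderiv_eq_zero (ν : Measure E)
    [IsFiniteMeasureOnCompacts ν] (v : E)
    (h : ∀ g : E → ℝ, ContDiff ℝ 1 g → HasCompactSupport g → ∫ x, fderiv ℝ g x v ∂ν = 0)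
    {g : E → ℝ} (hg : ContDiff ℝ 1 g) (hgs : HasCompactSupport g) :
    ∫ x, g (v + x) ∂ν = ∫ x, g x ∂ν := by
  have hshift : ∀ y : E, HasCompactSupport fun x => g (y + x) := fun y =>
    hgs.comp_homeomorph (Homeomorph.addLeft y)
  have hcd : Continuous (fderiv ℝ g) := hg.continuous_fderiv one_ne_zero
  have hgd : Differentiable ℝ g := hg.differentiable one_ne_zero
  have hderiv : ∀ t x, HasDerivAt (fun s : ℝ => g (s • v + x)) (fderiv ℝ g (t • v + x) v) t := by
    intro t x
    have h1 : HasDerivAt (fun s : ℝ => s • v + x) v t := by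
      simpa using ((hasDerivAt_id t).smul_const v).add_const x
    exact (hgd _).hasFDerivAt.comp_hasDerivAt t h1
  obtain ⟨M, hM⟩ := (hgs.fderiv_apply ℝ v).exists_bound_of_continuous
    (hcd.clm_apply continuous_const)
  obtain ⟨R, hR⟩ := hgs.isCompact.isBounded.subset_closedBall (0 : E)
  have hvanish : ∀ x, R < ‖x‖ → fderiv ℝ g x = 0 := fun x hx => by
    by_contra hne
    have := hR (support_fderiv_subset ℝ hne)
    rw [mem_closedBall_zero_iff] at this
    linarith
  have key : ∀ t : ℝ, HasDerivAt (fun s : ℝ => ∫ x, g (s • v + x) ∂ν) 0 t := by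
    intro t
    set S := R + (|t| + 1) * ‖v‖
    have hd := (hasDerivAt_integral_of_dominated_loc_of_deriv_le (μ := ν)
      (F := fun s x => g (s • v + x)) (F' := fun s x => fderiv ℝ g (s • v + x) v)
      (bound := (closedBall (0 : E) S).indicator fun _ => M)
      (ball_mem_nhds t one_pos)
      (Eventually.of_forall fun s => by
        have := hg.continuous
        exact (by fun_prop : Continuous fun x => g (s • v + x)).aestronglyMeasurable)
      ((hg.continuous.comp (by fun_prop)).integrable_of_hasCompactSupport (hshift _))
      ((hcd.comp (by fun_prop)).clm_apply continuous_const).aestronglyMeasurable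
      (Eventually.of_forall fun x s hs => ?_)
      ((integrable_indicator_iff measurableSet_closedBall).2 <|
        continuous_const.continuousOn.integrableOn_compact (isCompact_closedBall _ _))
      (Eventually.of_forall fun x s _ => hderiv s x)).2
    · have hzero : ∫ x, fderiv ℝ g (t • v + x) v ∂ν = 0 := by
        rw [← h (fun x => g (t • v + x)) (hg.comp (by fun_prop)) (hshift _)]
        simp_rw [fderiv_comp_add_left]
      rwa [hzero] at hd
    · by_cases hx : x ∈ closedBall (0 : E) S
      · rw [Set.indicator_of_mem hx]
        exact hM _
      · rw [Set.indicator_of_notMem hx, hvanish, zero_apply, norm_zero]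
        rw [mem_closedBall_zero_iff, not_le] at hx
        have hs' : |s| ≤ |t| + 1 := by
          rw [mem_ball, Real.dist_eq] at hs
          have := abs_sub_abs_le_abs_sub s t
          linarith
        have h1 : ‖s • v‖ ≤ (|t| + 1) * ‖v‖ := by
          rw [norm_smul, Real.norm_eq_abs]
          gcongr
        have h2 := norm_sub_le (s • v + x) (s • v)
        rw [add_sub_cancel_left] at h2
        simp only [S] at hx
        linarith
  have := is_const_of_deriv_eq_zero (fun t => (key t).differentiableAt) (fun t => (key t).deriv) 1 0
  simpa using this

lemma isAddLeftInvariant_of_integral_fderiv_eq_zero (ν : Measure E) [IsFiniteMeasureOnCompacts ν]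
    (h : ∀ (v : E) (g : E → ℝ), ContDiff ℝ 1 g → HasCompactSupport g →
      ∫ x, fderiv ℝ g x v ∂ν = 0) :
    ν.IsAddLeftInvariant := by
  refine ⟨fun v => ?_⟩
  have hemb : MeasurableEmbedding fun x : E => v + x :=
    (Homeomorph.addLeft v).measurableEmbedding
  have hfin : IsFiniteMeasureOnCompacts (ν.map fun x => v + x) :=
    MeasureTheory.Measure.IsFiniteMeasureOnCompacts.map ν (Homeomorph.addLeft v)
  refine Measure.ext_of_integral_eq_on_compactlySupported fun f => ?_
  obtain ⟨φ, hφ, hφ1⟩ := exists_seq_contDiffBump_tendsto (E := E)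
  let lam : Measure E := Measure.addHaar
  have h1 := tendsto_integral_normed_convolution_mul (lam := lam) (ν.map fun x => v + x) hφ hφ1
    f.continuous f.hasCompactSupport (w := fun _ => 1) continuous_const
  have h2 := tendsto_integral_normed_convolution_mul (lam := lam) ν hφ hφ1
    f.continuous f.hasCompactSupport (w := fun _ => 1) continuous_const
  simp only [mul_one] at h1 h2
  refine tendsto_nhds_unique h1 (h2.congr fun n => ?_)
  rw [hemb.integral_map]
  exact (integral_comp_add_eq_of_integral_fderiv_eq_zero ν v (h v)
    (((φ n).contDiff_normed_convolution f.continuous).of_le (by exact_mod_cast le_top))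
    ((φ n).hasCompactSupport_normed_convolution f.hasCompactSupport)).symm

theorem exists_eq_smul_withDensity_exp_neg {H : E → ℝ} (hH : ContDiff ℝ 1 H) (μ : Measure E)
    [IsLocallyFiniteMeasure μ]
    (h : ∀ (v : E) (g : E → ℝ), ContDiff ℝ (⊤ : ℕ∞) g → HasCompactSupport g →
      ∫ x, fderiv ℝ g x v ∂μ = ∫ x, g x * fderiv ℝ H x v ∂μ) :
    ∃ c : ℝ≥0, μ = (c : ENNReal) • lam.withDensity fun x => ENNReal.ofReal (Real.exp (-H x)) := by
  have hHc := hH.continuous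
  have hexp : Continuous fun x => Real.exp (H x) := Real.continuous_exp.comp hHc
  set ν := μ.withDensity fun x => ENNReal.ofReal (Real.exp (H x))
  have : IsLocallyFiniteMeasure ν := IsLocallyFiniteMeasure.withDensity_ofReal hexp
  have : ν.IsAddLeftInvariant := by
    refine isAddLeftInvariant_of_integral_fderiv_eq_zero ν fun v g hg hgs => ?_
    have hcd : Continuous fun x => fderiv ℝ H x v :=
      (hH.continuous_fderiv one_ne_zero).clm_apply continuous_const
    have hcg : Continuous fun x => fderiv ℝ g x v :=
      (hg.continuous_fderiv one_ne_zero).clm_apply continuous_const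
    have hE := integral_fderiv_eq_of_forall_smooth μ v hcd (h v)
      (g := fun x => Real.exp (H x) * g x) (hH.exp.mul hg) hgs.mul_left
    have hfd : ∀ x, fderiv ℝ (fun x => Real.exp (H x) * g x) x v =
        Real.exp (H x) * fderiv ℝ g x v + Real.exp (H x) * g x * fderiv ℝ H x v := by
      intro x
      have hHx := (hH.differentiable one_ne_zero x).hasFDerivAt
      have hgx := (hg.differentiable one_ne_zero x).hasFDerivAt
      rw [(show HasFDerivAt (fun x => Real.exp (H x) * g x) _ x from hHx.exp.mul hgx).fderiv]
      simp
      ring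
    simp_rw [hfd] at hE
    rw [integral_add, add_eq_right] at hE
    · rw [integral_withDensity_eq_integral_toReal_smul (by fun_prop) (by simp)]
      simpa [ENNReal.toReal_ofReal (Real.exp_nonneg _)] using hE
    · exact (hexp.mul hcg).integrable_of_hasCompactSupport (hgs.fderiv_apply ℝ v).mul_left
    · exact ((hexp.mul hg.continuous).mul hcd).integrable_of_hasCompactSupport
        hgs.mul_left.mul_right
  have hν := Measure.isAddLeftInvariant_eq_smul ν lam
  refine ⟨Measure.addHaarScalarFactor ν lam, ?_⟩
  rw [← withDensity_smul_measure, ← ENNReal.smul_def, ← hν,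
    ← withDensity_mul _ (by fun_prop) (by fun_prop)]
  have : ((fun x => ENNReal.ofReal (Real.exp (H x))) *
      fun x => ENNReal.ofReal (Real.exp (-H x))) = 1 := by
    ext x
    simp [← ENNReal.ofReal_mul (Real.exp_nonneg _), ← Real.exp_add]
  rw [this, withDensity_one]

end Mollification

section Poisson

variable {m : ℕ}

lemma poissonBracket_congr_left {f f' g : (Fin (2 * m) → ℝ) → ℝ} {x : Fin (2 * m) → ℝ}
    (h : f =ᶠ[𝓝 x] f') : poissonBracket m f g x = poissonBracket m f' g x := by
  simp only [poissonBracket, h.fderiv_eq]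

lemma poissonBracket_eq_zero_of_fderiv_right {f g : (Fin (2 * m) → ℝ) → ℝ} {x : Fin (2 * m) → ℝ}
    (h : fderiv ℝ g x = 0) : poissonBracket m f g x = 0 := by
  simp [poissonBracket, h]

lemma eq_sum_symplectic_single (v : Fin (2 * m) → ℝ) :
    v = ∑ i : Fin m,
      (v ⟨m + i.1, by omega⟩ • (Pi.single ⟨m + i.1, by omega⟩ 1 : Fin (2 * m) → ℝ) +
        v ⟨i.1, by omega⟩ • (Pi.single ⟨i.1, by omega⟩ 1 : Fin (2 * m) → ℝ)) := by
  ext ⟨k, hk⟩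
  simp only [Finset.sum_apply, Pi.add_apply, Pi.smul_apply, smul_eq_mul, Pi.single_apply,
    Fin.mk.injEq, mul_ite, mul_one, mul_zero]
  rcases lt_or_ge k m with h | h
  · rw [Finset.sum_eq_single ⟨k, h⟩]
    · simp only [if_true, show k ≠ m + k by omega, if_false, zero_add]
    · rintro ⟨i, hi⟩ - hne
      have : k ≠ i := fun h => hne (by simp [h])
      simp [show k ≠ m + i by omega, this]
    · simp
  · rw [Finset.sum_eq_single ⟨k - m, by omega⟩]
    · simp [show m + (k - m) = k by omega, show k ≠ k - m by omega]
    · rintro ⟨i, hi⟩ - hne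
      have : k ≠ m + i := fun h => hne (by simp [h])
      simp [show k ≠ i by omega, this]
    · simp

/-- The linear function whose bracket with any `g` is the derivative of `g` along `v`. -/
noncomputable def linearHamiltonian (v : Fin (2 * m) → ℝ) : (Fin (2 * m) → ℝ) →L[ℝ] ℝ :=
  ∑ i : Fin m,
    (v ⟨m + i.1, by omega⟩ • (proj ⟨i.1, by omega⟩ : (Fin (2 * m) → ℝ) →L[ℝ] ℝ) -
      v ⟨i.1, by omega⟩ • (proj ⟨m + i.1, by omega⟩ : (Fin (2 * m) → ℝ) →L[ℝ] ℝ))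

lemma linearHamiltonian_single_left (v : Fin (2 * m) → ℝ) (i : Fin m) :
    linearHamiltonian v (Pi.single ⟨i.1, by omega⟩ 1) = v ⟨m + i.1, by omega⟩ := by
  simp only [linearHamiltonian, sum_apply, sub_apply, smul_apply, proj_apply, Pi.single_apply,
    Fin.mk.injEq, smul_eq_mul, mul_ite, mul_one, mul_zero]
  rw [Finset.sum_eq_single i]
  · simp [i.pos.ne']
  · intro j _ hne
    simp [show j.1 ≠ i.1 from fun h => hne (Fin.ext h), show m + j.1 ≠ i by omega]
  · simp

lemma linearHamiltonian_single_right (v : Fin (2 * m) → ℝ) (i : Fin m) :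
    linearHamiltonian v (Pi.single ⟨m + i.1, by omega⟩ 1) = -v ⟨i.1, by omega⟩ := by
  simp only [linearHamiltonian, sum_apply, sub_apply, smul_apply, proj_apply, Pi.single_apply,
    Fin.mk.injEq, smul_eq_mul, mul_ite, mul_one, mul_zero]
  rw [Finset.sum_eq_single i]
  · simp [i.pos.ne']
  · intro j _ hne
    simp [show j.1 ≠ i.1 from fun h => hne (Fin.ext h), show j.1 ≠ m + i by omega]
  · simp

lemma poissonBracket_linearHamiltonian (v : Fin (2 * m) → ℝ) (g : (Fin (2 * m) → ℝ) → ℝ)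
    (x : Fin (2 * m) → ℝ) :
    poissonBracket m (linearHamiltonian v) g x = fderiv ℝ g x v := by
  conv_rhs => rw [eq_sum_symplectic_single v]
  simp only [poissonBracket, ContinuousLinearMap.fderiv, linearHamiltonian_single_left,
    linearHamiltonian_single_right, map_sum, map_add, map_smul, smul_eq_mul, neg_mul,
    sub_neg_eq_add]

lemma integral_fderiv_eq_of_kms {H : (Fin (2 * m) → ℝ) → ℝ} {μ : Measure (Fin (2 * m) → ℝ)}
    (hKMS : ∀ f g : (Fin (2 * m) → ℝ) → ℝ, ContDiff ℝ (⊤ : ℕ∞) f → ContDiff ℝ (⊤ : ℕ∞) g →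
      HasCompactSupport f → HasCompactSupport g →
      ∫ x, poissonBracket m f g x ∂μ = ∫ x, g x * poissonBracket m f H x ∂μ)
    (v : Fin (2 * m) → ℝ) {g : (Fin (2 * m) → ℝ) → ℝ} (hg : ContDiff ℝ (⊤ : ℕ∞) g)
    (hgs : HasCompactSupport g) :
    ∫ x, fderiv ℝ g x v ∂μ = ∫ x, g x * fderiv ℝ H x v ∂μ := by
  obtain ⟨R, hR0, hR⟩ := hgs.isCompact.isBounded.subset_ball_lt 0 (0 : Fin (2 * m) → ℝ)
  let χ : ContDiffBump (0 : Fin (2 * m) → ℝ) := ⟨R, R + 1, hR0, lt_add_one R⟩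
  have key := hKMS (fun x => χ x * linearHamiltonian v x) g
    (χ.contDiff.mul (linearHamiltonian v).contDiff) hg χ.hasCompactSupport.mul_right hgs
  have hloc : ∀ x ∈ tsupport g,
      (fun x => χ x * linearHamiltonian v x) =ᶠ[𝓝 x] linearHamiltonian v := fun x hx => by
    filter_upwards [χ.eventuallyEq_one_of_mem_ball (hR hx)] with y hy
    simp [hy]
  have hl : ∀ x, poissonBracket m (fun x => χ x * linearHamiltonian v x) g x =
      fderiv ℝ g x v := fun x => by
    by_cases hx : x ∈ tsupport g
    · rw [poissonBracket_congr_left (hloc x hx), poissonBracket_linearHamiltonian]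
    · have h0 : fderiv ℝ g x = 0 :=
        Function.notMem_support.1 fun h => hx (support_fderiv_subset ℝ h)
      simp [poissonBracket_eq_zero_of_fderiv_right h0, h0]
  have hr : ∀ x, g x * poissonBracket m (fun x => χ x * linearHamiltonian v x) H x =
      g x * fderiv ℝ H x v := fun x => by
    by_cases hx : x ∈ tsupport g
    · rw [poissonBracket_congr_left (hloc x hx), poissonBracket_linearHamiltonian]
    · simp [image_eq_zero_of_notMem_tsupport hx]
  simpa only [hl, hr] using key

end Poisson

/-- Let `m ≥ 1`, `H : ℝ^{2m} → ℝ` be `C¹`, and let `μ` be a finite Borel measure on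
`ℝ^{2m}` satisfying the classical KMS condition `∫ {f,g} dμ = ∫ g {f,H} dμ` for all
smooth compactly supported `f, g`. Then there is a constant `c ≥ 0` such that `μ` has
density `c·e^{-H}` with respect to Lebesgue measure: `μ(A) = c ∫_A e^{-H} dx` for every
Borel set `A`. -/
theorem stmt14 (m : ℕ) (hm : 1 ≤ m) (H : (Fin (2 * m) → ℝ) → ℝ) (hH : ContDiff ℝ 1 H)
    (μ : Measure (Fin (2 * m) → ℝ)) [IsFiniteMeasure μ]
    (hKMS : ∀ f g : (Fin (2 * m) → ℝ) → ℝ, ContDiff ℝ (⊤ : ℕ∞) f → ContDiff ℝ (⊤ : ℕ∞) g →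
      HasCompactSupport f → HasCompactSupport g →
      ∫ x, poissonBracket m f g x ∂μ = ∫ x, g x * poissonBracket m f H x ∂μ) :
    ∃ c : ℝ≥0, ∀ A : Set (Fin (2 * m) → ℝ), MeasurableSet A →
      μ A = c * ∫⁻ x in A, ENNReal.ofReal (Real.exp (-H x)) := by
  obtain ⟨c, hc⟩ := exists_eq_smul_withDensity_exp_neg (lam := volume) hH μ fun v g hg hgs =>
    integral_fderiv_eq_of_kms hKMS v hg hgs
  refine ⟨c, fun A hA => ?_⟩
  conv_lhs => rw [hc]
  rw [Measure.smul_apply, withDensity_apply _ hA, smul_eq_mul]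
end
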